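/- arXiv:2010.02444 — 2 statements merged into one kernel-verified Lean document; each statement's English description precedes it below -/
import Mathlib

section
/- Let k ≥ 1 be an integer, let y, ŷ ∈ ℝ, let q = ⌊y + 1/2⌋, and let q̂ = q + 2^{k−1}·⌊(ŷ − q)/2^{k−1} + 1/2⌋ be the quantization index congruent to q modulo 2^{k−1} whose quantization-interval center is closest to ŷ (ties broken upward). Then q̂ ≡ q (mod 2^k) if and only if ŷ ∈ ⋃_{j∈ℤ} [ q + j·2^k − 2^{k−2}, q + j·2^k + 2^{k−2} ), i.e., if and only if ŷ lies in the union of consistent intervals C(y) = ⌊y + 1/2⌋ + ⋃_{j∈ℤ} [−2^{k−2} + j·2^k, j·2^k + 2^{k−2}). -/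
open Set

/-- The predicted quantization index `qh = q + 2^{k−1}·⌊(yh − q)/2^{k−1} + 1/2⌋` agrees with `q`
in the `k`-th least significant bit (i.e. `qh ≡ q (mod 2^k)`) if and only if the prediction `yh`
lies in the union of consistent intervals
`C(y) = ⌊y + 1/2⌋ + ⋃_{j∈ℤ} [−2^{k−2} + j·2^k, j·2^k + 2^{k−2})`. -/
theorem bit_prediction_correct_iff_consistent
    (k : ℕ) (hk : 1 ≤ k) (y yh : ℝ)
    (q qh : ℤ) (hq : q = ⌊y + 1 / 2⌋)
    (hqh : qh = q + 2 ^ (k - 1) * ⌊(yh - (q : ℝ)) / 2 ^ (k - 1) + 1 / 2⌋) :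
    qh ≡ q [ZMOD ((2 : ℤ) ^ k)] ↔
      ∃ j : ℤ, yh ∈ Set.Ico ((q : ℝ) + (j : ℝ) * 2 ^ k - 2 ^ ((k : ℤ) - 2))
        ((q : ℝ) + (j : ℝ) * 2 ^ k + 2 ^ ((k : ℤ) - 2)) := by
  obtain ⟨n, rfl⟩ : ∃ n, k = n + 1 := ⟨k - 1, by omega⟩
  simp only [Nat.add_sub_cancel] at hqh
  have hz : (2 : ℝ) ^ (((n + 1 : ℕ) : ℤ) - 2) = 2 ^ n / 2 := by
    have : (((n + 1 : ℕ) : ℤ) - 2) = (n : ℤ) - 1 := by push_cast; ring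
    rw [this, zpow_sub₀ (by norm_num), zpow_natCast, zpow_one]
  rw [hz]
  have hP : (0 : ℝ) < 2 ^ n := by positivity
  have hd : qh ≡ q [ZMOD ((2 : ℤ) ^ (n + 1))] ↔
      ∃ j : ℤ, ⌊(yh - (q : ℝ)) / 2 ^ n + 1 / 2⌋ = 2 * j := by
    rw [Int.modEq_comm, Int.modEq_iff_dvd, hqh, add_sub_cancel_left, pow_succ,
      mul_dvd_mul_iff_left (by positivity)]
    rfl
  rw [hd]
  refine exists_congr fun j => ?_
  rw [Int.floor_eq_iff, Set.mem_Ico, pow_succ]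
  have e : yh = q + (yh - q) / 2 ^ n * 2 ^ n := by field_simp; ring
  generalize (yh - (q : ℝ)) / 2 ^ n = t at e ⊢
  generalize (2 : ℝ) ^ n = P at *
  subst e
  push_cast
  constructor
  · rintro ⟨h1, h2⟩
    constructor <;> nlinarith
  · rintro ⟨h1, h2⟩
    constructor
    · by_contra! h
      nlinarith
    · by_contra! h
      nlinarith
end

section
/- Let z ∈ ℝ be fixed and let W be a random variable uniformly distributed on [−1, 0). Then the random variable ⌊z + W + 1/2⌋ − (z + W), i.e., the quantization error of the dithered value z + W under the quantizer Q(y) = ⌊y + 1/2⌋, is uniformly distributed on an interval of length 1 centered at 0: its law is the uniform distribution on (−1/2, 1/2]. -/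
open MeasureTheory

/-- If `W` is uniform on `[−1, 0)`, then the quantization error `⌊z + W + 1/2⌋ − (z + W)` of the
dithered value `z + W` under the quantizer `Q(y) = ⌊y + 1/2⌋` is uniformly distributed on an
interval of length `1` centered at `0`: its law is the uniform distribution on `(−1/2, 1/2]`. -/
theorem dithered_quantization_error_uniform
    {Ω : Type*} [MeasurableSpace Ω] (P : Measure Ω) [IsProbabilityMeasure P]
    (z : ℝ) (W : Ω → ℝ) (hW_meas : Measurable W)
    (hW : Measure.map W P = volume.restrict (Set.Ico (-1 : ℝ) 0)) :
    Measure.map (fun ω => (⌊z + W ω + 1 / 2⌋ : ℝ) - (z + W ω)) P =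
      volume.restrict (Set.Ioc (-(1 / 2) : ℝ) (1 / 2)) := by
  have hf : Measurable (fun w : ℝ => (⌊z + w + 1 / 2⌋ : ℝ) - (z + w)) := by
    have h1 : Measurable (fun w : ℝ => ⌊z + w + 1 / 2⌋) :=
      Int.measurable_floor.comp (by fun_prop)
    have h2 : Measurable (fun w : ℝ => ((⌊z + w + 1 / 2⌋ : ℤ) : ℝ)) :=
      (measurable_from_top (f := fun n : ℤ => (n : ℝ))).comp h1
    exact h2.sub (by fun_prop)
  have hcomp : Measure.map (fun ω => (⌊z + W ω + 1 / 2⌋ : ℝ) - (z + W ω)) P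
      = Measure.map (fun w : ℝ => (⌊z + w + 1 / 2⌋ : ℝ) - (z + w)) (Measure.map W P) :=
    (Measure.map_map hf hW_meas).symm
  rw [hcomp, hW]
  ext s hs
  rw [Measure.map_apply hf hs, Measure.restrict_congr_set Ico_ae_eq_Ioc,
    Measure.restrict_apply (hf hs), Measure.restrict_apply hs]
  have d1 := isAddFundamentalDomain_Ioc (T := 1) one_pos (-1) volume
  have d2 := isAddFundamentalDomain_Ioc (T := 1) one_pos (-z - 1 / 2) volume
  have key := d1.measure_set_eq d2 (A := (fun w : ℝ => (⌊z + w + 1 / 2⌋ : ℝ) - (z + w)) ⁻¹' s)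
    (hf hs) (by
      rintro ⟨g, hg⟩
      obtain ⟨n, rfl⟩ := AddSubgroup.mem_zmultiples_iff.1 hg
      ext w
      have h : z + (n + w) + 1 / 2 = z + w + 1 / 2 + (n : ℝ) := by ring
      have h' : (⌊z + (n + w) + 1 / 2⌋ : ℝ) - (z + (n + w))
          = (⌊z + w + 1 / 2⌋ : ℝ) - (z + w) := by
        rw [h, Int.floor_add_intCast]; push_cast; ring
      simp only [Set.mem_preimage, AddSubgroup.vadd_def, vadd_eq_add, zsmul_eq_mul, mul_one]
      rw [h'])
  rw [show (-1 : ℝ) + 1 = 0 by norm_num] at key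
  rw [key, ← Measure.restrict_apply (hf hs), ← Measure.restrict_congr_set Ico_ae_eq_Ioc,
    Measure.restrict_apply (hf hs),
    ← (Measure.measurePreserving_sub_left volume (-z)).measure_preimage
      (hs.inter measurableSet_Ioc).nullMeasurableSet]
  congr 1
  ext w
  simp only [Set.mem_inter_iff, Set.mem_preimage, Set.mem_Ico, Set.mem_Ioc]
  have e : (-z - 1 / 2 ≤ w ∧ w < -z - 1 / 2 + 1) ↔ (-(1 / 2) < -z - w ∧ -z - w ≤ 1 / 2) := by
    constructor <;> rintro ⟨a, b⟩ <;> constructor <;> linarith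
  rw [e]
  refine and_congr_left fun h => ?_
  have h0 : ⌊z + w + 1 / 2⌋ = 0 := by
    rw [Int.floor_eq_zero_iff]
    constructor <;> linarith [h.1, h.2]
  rw [h0, show ((0 : ℤ) : ℝ) - (z + w) = -z - w by push_cast; ring]
end
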